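/- arXiv:1105.0142 — 3 statements merged into one kernel-verified Lean document; each statement's English description precedes it below -/
import Mathlib

section
/- For any integral domain D with quotient field K ≠ D, the following conditions are equivalent: (1) every v-invertible nonzero ideal of D is t-invertible; (2) every t-maximal ideal of D is v-maximal, i.e., maximal among the v-ideals properly contained in D; (3) every t-maximal ideal of D equals (aD :_D bD) for some a, b ∈ D with a ≠ 0; (4) for every nonzero ideal I of D, I_t = D if and only if I_v = D. -/
namespace IVP

open Polynomial

variable {F : Type} [Field F]

/-- Integer-valued polynomials on the set `E` with values in `D`:
`Int(E,D) = {f ∈ F[X] : f(E) ⊆ D}`. -/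
def IntOn (E D : Set F) : Set (Polynomial F) := {f | ∀ x ∈ E, f.eval x ∈ D}

/-- `Int(D) = {f ∈ F[X] : f(D) ⊆ D}`. -/
def IntR (D : Set F) : Set (Polynomial F) := IntOn D D

/-- Polynomials with all coefficients in `R`, i.e. `R[X]` as a subset of `F[X]`. -/
def polySet (R : Set F) : Set (Polynomial F) := {f | ∀ n, f.coeff n ∈ R}

/-- `I⁻¹ = (D :_K I) = {x : x·I ⊆ D}`. -/
def dinv (D I : Set F) : Set F := {x | ∀ y ∈ I, x * y ∈ D}

/-- `I_v = (I⁻¹)⁻¹`. -/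
def dv (D I : Set F) : Set F := dinv D (dinv D I)

/-- `I_t = ⋃ J_v`, the union over all nonzero finitely generated fractional ideals
`J ⊆ I`; such a `J` is the `D`-span of a finite set `T ⊆ I` containing a nonzero
element, and `J_v` depends only on `T`. -/
def dt (D I : Set F) : Set F :=
  {x | ∃ T : Finset F, ↑T ⊆ I ∧ (∃ y ∈ T, y ≠ 0) ∧ x ∈ dv D ↑T}

/-- The image in `F` of a set of elements of the subring `D`. -/
def iset (D : Subring F) (I : Set ↥D) : Set F := (↑) '' I

/-- `I` is a t-ideal: `I_t = I`. -/
def IsTIdeal (D I : Set F) : Prop := dt D I = I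

/-- `I` is a v-ideal: `I_v = I`. -/
def IsVIdeal (D I : Set F) : Prop := dv D I = I

/-- `p` is a t-maximal ideal of `D`: maximal among the t-ideals properly contained
in `D`. -/
def IsTMax (D : Subring F) (p : Ideal ↥D) : Prop :=
  p ≠ ⊤ ∧ IsTIdeal ↑D (iset D ↑p) ∧
    ∀ q : Ideal ↥D, q ≠ ⊤ → IsTIdeal ↑D (iset D ↑q) → p ≤ q → p = q

/-- `p` is a v-maximal ideal of `D`: maximal among the v-ideals properly contained
in `D`. -/
def IsVMax (D : Subring F) (p : Ideal ↥D) : Prop :=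
  p ≠ ⊤ ∧ IsVIdeal ↑D (iset D ↑p) ∧
    ∀ q : Ideal ↥D, q ≠ ⊤ → IsVIdeal ↑D (iset D ↑q) → p ≤ q → p = q

/-- The localization `S⁻¹D` of `D` at a multiplicative subset `S ⊆ D`, as a subset
of `F`. -/
def mlocSet (D : Subring F) (S : Set ↥D) : Set F :=
  {x | ∃ a : ↥D, ∃ s ∈ S, (s : F) * x = (a : F)}

/-- The localization `D_p` of `D` at the complement of `p`, as a subset of `F`. -/
def plocSet (D : Subring F) (p : Ideal ↥D) : Set F := mlocSet D {s | s ∉ p}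

/-- The localization `S⁻¹R` of a set `R` of polynomials at a multiplicative subset
`S ⊆ D`, as a subset of `F[X]`. -/
def mlocPoly (D : Subring F) (S : Set ↥D) (R : Set (Polynomial F)) : Set (Polynomial F) :=
  {f | ∃ g ∈ R, ∃ s ∈ S, C (s : F) * f = g}

/-- The localization `R_p` of a set `R` of polynomials at `D ∖ p`. -/
def plocPoly (D : Subring F) (p : Ideal ↥D) (R : Set (Polynomial F)) : Set (Polynomial F) :=
  mlocPoly D {s | s ∉ p} R

/-- The ideal `pD_p` of the localization `D_p`, as a subset of `F`. -/
def plocIdl (D : Subring F) (p : Ideal ↥D) : Set F :=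
  {x | ∃ y ∈ p, ∃ s : ↥D, s ∉ p ∧ (s : F) * x = ((y : ↥D) : F)}

/-- `p` is t-localizing: `pD_p` is a t-ideal of `D_p`. -/
def TLocalizing (D : Subring F) (p : Ideal ↥D) : Prop :=
  IsTIdeal (plocSet D p) (plocIdl D p)

/-- `F` is the quotient field of `D`. -/
def IsQuotField (D : Subring F) : Prop :=
  ∀ x : F, ∃ a b : ↥D, b ≠ 0 ∧ (b : F) * x = (a : F)

/-- The quotient field of `D`, as a subset of the ambient field. -/
def fracSet (D : Subring F) : Set F :=
  {x | ∃ a b : ↥D, b ≠ 0 ∧ (b : F) * x = (a : F)}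

/-- The conductor ideal `(aD :_D bD) = {d ∈ D : d·b ∈ aD}` of `D`. -/
def Conductor (D : Subring F) (a b : ↥D) : Set ↥D := {d | ∃ c : ↥D, d * b = a * c}

/-- Elementwise product of two subsets of `F`. -/
def setMul (A B : Set F) : Set F := {z | ∃ x ∈ A, ∃ y ∈ B, z = x * y}

/-- The ideal `I` of `D` is t-invertible: `(I⁻¹I)_t = D`. -/
def TInv (D : Subring F) (I : Ideal ↥D) : Prop :=
  dt ↑D (setMul (dinv ↑D (iset D ↑I)) (iset D ↑I)) = (↑D : Set F)

/-- The ideal `I` of `D` is v-invertible: `(I⁻¹I)_v = D`. -/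
def VInv (D : Subring F) (I : Ideal ↥D) : Prop :=
  dv ↑D (setMul (dinv ↑D (iset D ↑I)) (iset D ↑I)) = (↑D : Set F)

/-- `D` is a PVMD: every nonzero finitely generated ideal of `D` is t-invertible. -/
def IsPVMD (D : Subring F) : Prop :=
  ∀ I : Ideal ↥D, I ≠ ⊥ → I.FG → TInv D I

/-- `D` is an H domain: every v-invertible nonzero ideal of `D` is t-invertible. -/
def IsHDomain (D : Subring F) : Prop :=
  ∀ I : Ideal ↥D, I ≠ ⊥ → VInv D I → TInv D I

/-- `p ∈ sKr(K/D)`: `p` is a prime such that every finitely generated ideal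
`I ⊆ p` satisfies `I ⊆ J ⊆ p` for some conductor ideal `J` of `D`. -/
def SKrMem (D : Subring F) (p : Ideal ↥D) : Prop :=
  p.IsPrime ∧ ∀ I : Ideal ↥D, I.FG → I ≤ p →
    ∃ a b : ↥D, a ≠ 0 ∧ (↑I : Set ↥D) ⊆ Conductor D a b ∧ Conductor D a b ⊆ ↑p

/-- The localization `A_p` of `A ⊇ D` at the complement in `D` of a prime `p` of `D`,
as a subset of the ambient field. -/
def mixedLocSet (D A : Subring F) (p : Ideal ↥D) : Set F :=
  {x | ∃ a : ↥A, ∃ s : ↥D, s ∉ p ∧ (s : F) * x = (a : F)}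

/-- `pD_p` is a principal ideal of `D_p`. -/
def PLocPrincipal (D : Subring F) (p : Ideal ↥D) : Prop :=
  ∃ g : F, plocIdl D p = {x | ∃ d ∈ plocSet D p, x = d * g}

/-- The localization `A_p` of `A ⊇ D` at a prime `p` of `D`, as a subring of the
ambient field. -/
def mixedLoc (D A : Subring F) (hDA : D ≤ A) (p : Ideal ↥D) (hp : p.IsPrime) :
    Subring F where
  carrier := mixedLocSet D A p
  one_mem' := ⟨1, 1, fun h => hp.ne_top (Ideal.eq_top_of_isUnit_mem p h isUnit_one), by simp⟩
  zero_mem' := ⟨0, 1, fun h => hp.ne_top (Ideal.eq_top_of_isUnit_mem p h isUnit_one), by simp⟩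
  mul_mem' := by
    rintro x y ⟨a, s, hs, hx⟩ ⟨b, t, ht, hy⟩
    refine ⟨a * b, s * t, fun h => ((hp.mem_or_mem h).elim hs ht), ?_⟩
    push_cast
    rw [mul_mul_mul_comm, hx, hy]
  add_mem' := by
    rintro x y ⟨a, s, hs, hx⟩ ⟨b, t, ht, hy⟩
    refine ⟨⟨t, hDA t.2⟩ * a + ⟨s, hDA s.2⟩ * b, s * t,
      fun h => ((hp.mem_or_mem h).elim hs ht), ?_⟩
    push_cast
    rw [mul_add]
    rw [show ((s:F) * t) * x = (t:F) * ((s:F) * x) by ring, hx,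
      show ((s:F) * t) * y = (s:F) * ((t:F) * y) by ring, hy]
  neg_mem' := by
    rintro x ⟨a, s, hs, hx⟩
    exact ⟨-a, s, hs, by push_cast; rw [mul_neg, hx]⟩

/-- The localization `D_p` of `D` at a prime `p`, as a subring of `F`. -/
def primeLoc (D : Subring F) (p : Ideal ↥D) (hp : p.IsPrime) : Subring F :=
  mixedLoc D D le_rfl p hp

/-- `Int(D)` as a subring of `F[X]`. -/
def IntSubring (D : Subring F) : Subring (Polynomial F) where
  carrier := IntR ↑D
  one_mem' := fun x _ => by simpa using D.one_mem
  zero_mem' := fun x _ => by simpa using D.zero_mem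
  mul_mem' := fun hf hg x hx => by
    rw [eval_mul]; exact D.mul_mem (hf x hx) (hg x hx)
  add_mem' := fun hf hg x hx => by
    rw [eval_add]; exact D.add_mem (hf x hx) (hg x hx)
  neg_mem' := fun hf x hx => by
    rw [eval_neg]; exact D.neg_mem (hf x hx)

/-- `Int(D)` as a `D`-submodule of `F[X]`. -/
def intSubmodule (D : Subring F) : Submodule ↥D (Polynomial F) where
  carrier := IntR ↑D
  zero_mem' := fun x _ => by simpa using D.zero_mem
  add_mem' := fun hf hg x hx => by
    rw [eval_add]; exact D.add_mem (hf x hx) (hg x hx)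
  smul_mem' := fun c f hf x hx => by
    have h : c • f = C (c : F) * f := by
      rw [Algebra.smul_def]; rfl
    rw [h, eval_mul, eval_C]
    exact D.mul_mem c.2 (hf x hx)

/-- An overring `D'` of `D` as a `D`-submodule of `F`. -/
def subringSubmodule (D D' : Subring F) (h : D ≤ D') : Submodule ↥D F where
  carrier := ↑D'
  zero_mem' := D'.zero_mem
  add_mem' := fun ha hb => D'.add_mem ha hb
  smul_mem' := fun c x hx => by
    rw [Subring.smul_def]
    exact D'.mul_mem (h c.2) hx

/-- `Int(D)_p` as a `D_p`-submodule of `F[X]`. -/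
def plocIntSubmodule (D : Subring F) (p : Ideal ↥D) (hp : p.IsPrime) :
    Submodule ↥(primeLoc D p hp) (Polynomial F) where
  carrier := plocPoly D p (IntR ↑D)
  zero_mem' :=
    ⟨0, fun x _ => by simpa using D.zero_mem, 1,
      fun h => hp.ne_top (Ideal.eq_top_of_isUnit_mem p h isUnit_one), by simp⟩
  add_mem' := by
    rintro f f' ⟨g, hg, s, hs, hfg⟩ ⟨g', hg', t, ht, hfg'⟩
    refine ⟨C (t : F) * g + C (s : F) * g', ?_, s * t,
      fun h => ((hp.mem_or_mem h).elim hs ht), ?_⟩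
    · intro x hx
      rw [eval_add, eval_mul, eval_mul, eval_C, eval_C]
      exact D.add_mem (D.mul_mem t.2 (hg x hx)) (D.mul_mem s.2 (hg' x hx))
    · rw [← hfg, ← hfg']
      push_cast
      rw [map_mul]
      ring
  smul_mem' := by
    rintro c f ⟨g, hg, t, ht, hfg⟩
    obtain ⟨a, s, hs, hsc⟩ := c.2
    have h : c • f = C (c : F) * f := by rw [Algebra.smul_def]; rfl
    refine ⟨C (a : F) * g, ?_, s * t,
      fun hmem => ((hp.mem_or_mem hmem).elim hs ht), ?_⟩
    · intro x hx
      rw [eval_mul, eval_C]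
      exact D.mul_mem a.2 (hg x hx)
    · rw [h, ← hfg, ← hsc]
      push_cast
      rw [map_mul, map_mul]
      ring

section Extensions

variable {L : Type} [Field L]

/-- The data of an extension: the subring `A` of `L` contains the image of `D`
under the embedding `φ` of quotient fields. -/
def ExtMem (D : Subring F) (φ : F →+* L) (A : Subring L) : Prop := ∀ d : ↥D, φ d ∈ A

/-- The injective ring homomorphism `D → A` induced by `φ`. -/
noncomputable def extHom (D : Subring F) (φ : F →+* L) (A : Subring L)
    (h : ExtMem D φ A) : ↥D →+* ↥A :=
  (φ.comp D.subtype).codRestrict A.toSubsemiring (fun d => h d)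

/-- The extension `A ⊇ D` is polynomially regular: `Int(D,A) = A·Int(D)`. -/
def PolyReg (D : Subring F) (φ : F →+* L) (A : Subring L) : Prop :=
  IntOn (φ '' ↑D) ↑A = ↑(Submodule.span ↥A (Polynomial.map φ '' IntR (↑D : Set F)))

/-- The extension `A ⊇ D` is weakly polynomially complete: `Int(D) ⊆ Int(A)`. -/
def WPolyComplete (D : Subring F) (φ : F →+* L) (A : Subring L) : Prop :=
  Polynomial.map φ '' IntR (↑D : Set F) ⊆ IntR (↑A : Set L)

/-- The extension `A ⊇ D` is polynomially complete: `Int(D,A) = Int(A)`. -/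
def PolyComplete (D : Subring F) (φ : F →+* L) (A : Subring L) : Prop :=
  IntOn (φ '' ↑D) ↑A = IntR (↑A : Set L)

/-- The extension `A ⊇ D` is flat: `A` is flat as a `D`-module. -/
def ExtFlat (D : Subring F) (φ : F →+* L) (A : Subring L) (h : ExtMem D φ A) : Prop :=
  letI : Module ↥D ↥A := Module.compHom ↥A (extHom D φ A h)
  Module.Flat ↥D ↥A

/-- The extension `A ⊇ D` is t-linked: `I_t = D` implies `(IA)_t = A` for every
nonzero ideal `I` of `D`. -/
def TLinkedExt (D : Subring F) (φ : F →+* L) (A : Subring L) (h : ExtMem D φ A) : Prop :=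
  ∀ I : Ideal ↥D, I ≠ ⊥ → dt ↑D (iset D ↑I) = (↑D : Set F) →
    dt ↑A (iset A ↑(Ideal.map (extHom D φ A h) I)) = (↑A : Set L)

/-- `D` is absolutely polynomially regular: every extension of `D` is polynomially
regular. -/
def AbsPolyReg (D : Subring F) : Prop :=
  ∀ (L : Type) [Field L], ∀ (φ : F →+* L) (A : Subring L),
    ExtMem D φ A → IsQuotField A → PolyReg D φ A

/-- `D` is polynomially F-regular: every flat extension of `D` is polynomially
regular. -/
def PFReg (D : Subring F) : Prop :=
  ∀ (L : Type) [Field L], ∀ (φ : F →+* L) (A : Subring L) (h : ExtMem D φ A),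
    IsQuotField A → ExtFlat D φ A h → PolyReg D φ A

/-- `D` is polynomially t-regular: every t-linked extension of `D` is polynomially
regular. -/
def PTReg (D : Subring F) : Prop :=
  ∀ (L : Type) [Field L], ∀ (φ : F →+* L) (A : Subring L) (h : ExtMem D φ A),
    IsQuotField A → TLinkedExt D φ A h → PolyReg D φ A

/-- `D` is polynomially L-regular: `Int(S⁻¹D) = S⁻¹Int(D)` for every multiplicative
subset `S` of `D` with `0 ∉ S`. -/
def PLReg (D : Subring F) : Prop :=
  ∀ S : Submonoid ↥D, (0 : ↥D) ∉ S →
    IntR (mlocSet D ↑S) = mlocPoly D ↑S (IntR (↑D : Set F))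

end Extensions

/-- The extension of an ideal `I` of `R` to an overring `S` of `R` inside a common
field: the ideal `IS` of `S` generated by `I`. -/
def extIdeal (R S : Subring F) (I : Ideal ↥R) : Ideal ↥S :=
  Ideal.span {y : ↥S | (y : F) ∈ iset R ↑I}

/-- Within a common field: `S` is a t-linked extension of `R`. -/
def TLinkedSub (R S : Subring F) : Prop :=
  R ≤ S ∧ ∀ I : Ideal ↥R, I ≠ ⊥ → dt ↑R (iset R ↑I) = (↑R : Set F) →
    dt ↑S (iset S ↑(extIdeal R S I)) = (↑S : Set F)

/-- Localization of a subset `R` of the ambient field at `D ∖ q`. -/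
def locOfSet (D : Subring F) (R : Set F) (q : Ideal ↥D) : Set F :=
  {x | ∃ y ∈ R, ∃ s : ↥D, s ∉ q ∧ (s : F) * x = y}

end IVP

open IVP Polynomial

namespace IVP

variable {F : Type} [Field F]

theorem dinv_anti {D A B : Set F} (h : A ⊆ B) : dinv D B ⊆ dinv D A :=
  fun _ hx y hy => hx y (h hy)

theorem dv_mono {D A B : Set F} (h : A ⊆ B) : dv D A ⊆ dv D B :=
  dinv_anti (dinv_anti h)

theorem subset_dv (D A : Set F) : A ⊆ dv D A := fun x hx y hy => by
  rw [mul_comm]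
  exact hy x hx

theorem dv_dinv (D A : Set F) : dv D (dinv D A) = dinv D A :=
  Set.Subset.antisymm (dinv_anti (subset_dv D A)) (subset_dv D _)

theorem dv_subset_dv {D A B : Set F} (h : A ⊆ dv D B) : dv D A ⊆ dv D B :=
  (dv_mono h).trans (dv_dinv D (dinv D B)).subset

theorem dt_mono {D A B : Set F} (h : A ⊆ B) : dt D A ⊆ dt D B :=
  fun _ ⟨T, hT, h0, hx⟩ => ⟨T, hT.trans h, h0, hx⟩

theorem dt_subset_dv (D A : Set F) : dt D A ⊆ dv D A :=
  fun _ ⟨_, hT, _, hx⟩ => dv_mono hT hx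

theorem subset_dt (D : Set F) {A : Set F} {y : F} (hy : y ∈ A) (hy0 : y ≠ 0) :
    A ⊆ dt D A := by
  classical
  intro x hx
  refine ⟨{x, y}, ?_, ⟨y, by simp, hy0⟩, subset_dv _ _ (by simp)⟩
  simp [Set.insert_subset_iff, hx, hy]

theorem exists_finset_subset_dv {D A : Set F} (T : Finset F) (hT : ↑T ⊆ dt D A) :
    ∃ S : Finset F, ↑S ⊆ A ∧ ↑T ⊆ dv D (↑S : Set F) := by
  classical
  choose! S hS _ hx using hT
  refine ⟨T.biUnion S, ?_, fun x hxT => ?_⟩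
  · simpa using fun x hxT => hS hxT
  · exact dv_mono (by exact_mod_cast Finset.subset_biUnion_of_mem S hxT) (hx hxT)

theorem dt_subset_dt {D A B : Set F} {y : F} (hy : y ∈ B) (hy0 : y ≠ 0) (h : A ⊆ dt D B) :
    dt D A ⊆ dt D B := by
  classical
  rintro x ⟨T, hT, -, hx⟩
  obtain ⟨S, hSB, hTS⟩ := exists_finset_subset_dv T (hT.trans h)
  refine ⟨insert y S, ?_, ⟨y, by simp, hy0⟩, ?_⟩
  · simp [Set.insert_subset_iff, hy, hSB]
  · exact dv_mono (by simp) (dv_subset_dv hTS hx)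

theorem iset_subset (D : Subring F) (I : Set ↥D) : iset D I ⊆ D := by
  rintro _ ⟨x, -, rfl⟩
  exact x.2

theorem mem_iset {D : Subring F} {I : Set ↥D} {x : ↥D} : (x : F) ∈ iset D I ↔ x ∈ I :=
  Subtype.val_injective.mem_set_image

theorem one_notMem_iset {D : Subring F} {p : Ideal ↥D} (hp : p ≠ ⊤) :
    (1 : F) ∉ iset D (p : Set ↥D) :=
  fun h => hp ((Ideal.eq_top_iff_one p).2 (mem_iset.1 (D.coe_one ▸ h)))

theorem iset_mono {D : Subring F} {I J : Set ↥D} (h : I ⊆ J) : iset D I ⊆ iset D J :=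
  Set.image_mono h

theorem iset_preimage {D : Subring F} {A : Set F} (hA : A ⊆ D) :
    iset D ((↑) ⁻¹' A) = A := by
  rw [iset, Set.image_preimage_eq_iff]
  simpa using hA

theorem exists_ne_zero_mem_iset {D : Subring F} {I : Ideal ↥D} (hI : I ≠ ⊥) :
    ∃ y ∈ iset D ↑I, y ≠ 0 := by
  obtain ⟨y, hy, hy0⟩ := Submodule.exists_mem_ne_zero_of_ne_bot hI
  exact ⟨y, mem_iset.2 hy, by simpa using hy0⟩

/-- `(D :_K A)` as a `D`-submodule of `K`. -/
def dinvSubmodule (D : Subring F) (A : Set F) : Submodule ↥D F where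
  carrier := dinv D A
  zero_mem' := fun y _ => by simp
  add_mem' := fun ha hb y hy => by
    rw [add_mul]
    exact D.add_mem (ha y hy) (hb y hy)
  smul_mem' := fun c x hx y hy => by
    rw [Subring.smul_def, smul_eq_mul, mul_assoc]
    exact D.mul_mem c.2 (hx y hy)

/-- `(D :_D A)` as an ideal of `D`. -/
def dinvIdeal (D : Subring F) (A : Set F) : Ideal ↥D :=
  (dinvSubmodule D A).comap (Algebra.linearMap ↥D F)

theorem coe_dinvIdeal (D : Subring F) (A : Set F) :
    (dinvIdeal D A : Set ↥D) = (↑) ⁻¹' dinv (D : Set F) A := rfl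

theorem dv_subset {D : Subring F} {A : Set F} (hA : A ⊆ D) : dv (D : Set F) A ⊆ D :=
  fun x hx => by simpa using hx 1 fun y hy => by simpa using hA hy

theorem dt_subset {D : Subring F} {A : Set F} (hA : A ⊆ D) : dt (D : Set F) A ⊆ D :=
  (dt_subset_dv _ _).trans (dv_subset hA)

theorem dv_eq_iff_one_mem {D : Subring F} {A : Set F} (hA : A ⊆ D) :
    dv (D : Set F) A = D ↔ (1 : F) ∈ dv (D : Set F) A := by
  refine ⟨fun h => h.symm.subset D.one_mem, fun h => (dv_subset hA).antisymm fun x hx y hy => ?_⟩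
  exact D.mul_mem hx (by simpa using h y hy)

theorem dt_eq_iff_one_mem {D : Subring F} {A : Set F} (hA : A ⊆ D) :
    dt (D : Set F) A = D ↔ (1 : F) ∈ dt (D : Set F) A := by
  refine ⟨fun h => h.symm.subset D.one_mem, fun ⟨T, hT, h0, h1⟩ => (dt_subset hA).antisymm fun x hx => ?_⟩
  refine ⟨T, hT, h0, ?_⟩
  rwa [(dv_eq_iff_one_mem (hT.trans hA)).2 h1]

/-- The t-closure `I_t` of a nonzero ideal `I`, as an ideal of `D`. -/
def tIdeal (D : Subring F) (I : Ideal ↥D) (hI : I ≠ ⊥) : Ideal ↥D where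
  carrier := (↑) ⁻¹' dt (D : Set F) (iset D ↑I)
  zero_mem' := by
    obtain ⟨y, hy, hy0⟩ := exists_ne_zero_mem_iset hI
    exact subset_dt _ hy hy0 (mem_iset.2 I.zero_mem)
  add_mem' := by
    classical
    rintro a b ⟨S, hS, ⟨y, hy, hy0⟩, ha⟩ ⟨T, hT, -, hb⟩
    refine ⟨S ∪ T, by simp [hS, hT], ⟨y, by simp [hy], hy0⟩, ?_⟩
    exact (dinvSubmodule D _).add_mem (dv_mono (by simp) ha) (dv_mono (by simp) hb)
  smul_mem' := by
    rintro c x ⟨S, hS, h0, hx⟩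
    exact ⟨S, hS, h0, (dinvSubmodule D _).smul_mem c hx⟩

theorem iset_tIdeal {D : Subring F} {I : Ideal ↥D} (hI : I ≠ ⊥) :
    iset D ↑(tIdeal D I hI) = dt (D : Set F) (iset D ↑I) :=
  iset_preimage (dt_subset (iset_subset D _))

theorem le_tIdeal {D : Subring F} {I : Ideal ↥D} (hI : I ≠ ⊥) : I ≤ tIdeal D I hI := by
  obtain ⟨y, hy, hy0⟩ := exists_ne_zero_mem_iset hI
  exact fun x hx => subset_dt _ hy hy0 (mem_iset.2 hx)

theorem isTIdeal_tIdeal {D : Subring F} {I : Ideal ↥D} (hI : I ≠ ⊥) :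
    IsTIdeal (D : Set F) (iset D ↑(tIdeal D I hI)) := by
  obtain ⟨y, hy, hy0⟩ := exists_ne_zero_mem_iset hI
  rw [iset_tIdeal, IsTIdeal]
  exact (dt_subset_dt hy hy0 subset_rfl).antisymm
    (subset_dt _ (subset_dt _ hy hy0 hy) hy0)

theorem IsTIdeal.ne_bot {D : Subring F} {I : Ideal ↥D}
    (h : IsTIdeal (D : Set F) (iset D ↑I)) : I ≠ ⊥ := by
  rintro rfl
  have h0 : (0 : F) ∈ dt (D : Set F) (iset D ((⊥ : Ideal ↥D) : Set ↥D)) := by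
    rw [show dt _ _ = _ from h]
    exact ⟨0, by simp, rfl⟩
  obtain ⟨T, hT, ⟨y, hy, hy0⟩, -⟩ := h0
  obtain ⟨z, hz, rfl⟩ := hT hy
  rw [SetLike.mem_coe, Ideal.mem_bot] at hz
  simp [hz] at hy0

theorem IsVIdeal.isTIdeal {D : Subring F} {I : Ideal ↥D} (hI : I ≠ ⊥)
    (h : IsVIdeal (D : Set F) (iset D ↑I)) : IsTIdeal (D : Set F) (iset D ↑I) := by
  obtain ⟨y, hy, hy0⟩ := exists_ne_zero_mem_iset hI
  exact ((dt_subset_dv _ _).trans h.subset).antisymm (subset_dt _ hy hy0)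

/-- Every proper t-ideal is contained in a t-maximal ideal. -/
theorem exists_isTMax_ge {D : Subring F} {I : Ideal ↥D} (hI : I ≠ ⊤)
    (hIt : IsTIdeal (D : Set F) (iset D ↑I)) : ∃ p : Ideal ↥D, IsTMax D p ∧ I ≤ p := by
  have hchains : ∀ c ⊆ {q : Ideal ↥D | q ≠ ⊤ ∧ IsTIdeal (D : Set F) (iset D ↑q)},
      IsChain (· ≤ ·) c → ∀ y ∈ c,
        ∃ ub ∈ {q : Ideal ↥D | q ≠ ⊤ ∧ IsTIdeal (D : Set F) (iset D ↑q)}, ∀ z ∈ c, z ≤ ub := by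
    intro c hc hchain q hq
    have hdir : DirectedOn (· ≤ ·) c := hchain.directedOn
    have hmem (x : ↥D) : x ∈ sSup c ↔ ∃ r ∈ c, x ∈ r :=
      Submodule.mem_sSup_of_directed ⟨q, hq⟩ hdir
    have hle {r : Ideal ↥D} (hr : r ∈ c) : iset D (r : Set ↥D) ⊆ iset D ↑(sSup c) :=
      iset_mono (SetLike.coe_subset_coe.2 (le_sSup hr))
    refine ⟨sSup c, ⟨?_, ?_⟩, fun r hr => le_sSup hr⟩
    · rw [Ideal.ne_top_iff_one, hmem]
      rintro ⟨r, hr, h1⟩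
      exact (hc hr).1 ((Ideal.eq_top_iff_one r).2 h1)
    · have hcover (T : Finset F) (hT : ↑T ⊆ iset D ↑(sSup c)) :
          ∃ r ∈ c, ↑T ⊆ iset D (r : Set ↥D) := by
        classical
        induction T using Finset.induction_on with
        | empty => exact ⟨q, hq, by simp⟩
        | insert a S _ ih =>
          rw [Finset.coe_insert, Set.insert_subset_iff] at hT
          obtain ⟨r, hr, hSr⟩ := ih hT.2
          obtain ⟨a, ha, rfl⟩ := hT.1
          obtain ⟨r', hr', har'⟩ := (hmem a).1 ha
          obtain ⟨r'', hr'', h1, h2⟩ := hdir r hr r' hr'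
          refine ⟨r'', hr'', ?_⟩
          rw [Finset.coe_insert, Set.insert_subset_iff]
          exact ⟨mem_iset.2 (h2 har'), hSr.trans (iset_mono h1)⟩
      obtain ⟨y, hy, hy0⟩ := exists_ne_zero_mem_iset (hc hq).2.ne_bot
      refine Set.Subset.antisymm ?_ (subset_dt _ (hle hq hy) hy0)
      rintro x ⟨T, hT, h0, hx⟩
      obtain ⟨r, hr, hTr⟩ := hcover T hT
      have hxr : x ∈ dt (D : Set F) (iset D ↑r) := ⟨T, hTr, h0, hx⟩
      rw [show dt _ _ = _ from (hc hr).2] at hxr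
      exact hle hr hxr
  obtain ⟨p, hIp, hp⟩ := zorn_le_nonempty₀ _ hchains I ⟨hI, hIt⟩
  exact ⟨p, ⟨hp.prop.1, hp.prop.2, fun q hq hqt hpq => hp.eq_of_le ⟨hq, hqt⟩ hpq⟩, hIp⟩

theorem iset_span_subset_dinv {D : Subring F} {S : Set ↥D} {A : Set F}
    (h : iset D S ⊆ dinv (D : Set F) A) :
    iset D (Ideal.span S : Set ↥D) ⊆ dinv (D : Set F) A := by
  have hle : Ideal.span S ≤ dinvIdeal D A := Ideal.span_le.2 fun x hx => h (mem_iset.2 hx)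
  rintro _ ⟨x, hx, rfl⟩
  exact hle hx

theorem dv_iset_span (D : Subring F) (S : Set ↥D) :
    dv (D : Set F) (iset D (Ideal.span S : Set ↥D)) = dv (D : Set F) (iset D S) :=
  (dv_subset_dv (iset_span_subset_dinv (subset_dv _ _))).antisymm
    (dv_mono (iset_mono Ideal.subset_span))

theorem dt_iset_span {D : Subring F} {S : Set ↥D} {y : ↥D} (hy : y ∈ S) (hy0 : y ≠ 0) :
    dt (D : Set F) (iset D (Ideal.span S : Set ↥D)) = dt (D : Set F) (iset D S) := by
  classical
  refine Set.Subset.antisymm (dt_subset_dt (mem_iset.2 hy) (by simpa using hy0) ?_)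
    (dt_mono (iset_mono Ideal.subset_span))
  rintro _ ⟨x, hx, rfl⟩
  obtain ⟨T, hTS, hxT⟩ := Submodule.mem_span_finite_of_mem_span hx
  refine ⟨insert (y : F) (T.image (↑)), ?_, ⟨y, by simp, by simpa using hy0⟩, ?_⟩
  · rw [Finset.coe_insert, Finset.coe_image, Set.insert_subset_iff]
    exact ⟨mem_iset.2 hy, iset_mono hTS⟩
  · refine dv_mono (A := iset D (T : Set ↥D)) (by simp [iset]) ?_
    rw [← dv_iset_span]
    exact subset_dv _ _ (mem_iset.2 hxT)

theorem setMul_dinv_subset (D : Subring F) (A : Set F) :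
    setMul (dinv (D : Set F) A) A ⊆ D := by
  rintro _ ⟨x, hx, y, hy, rfl⟩
  exact hx y hy

theorem setMul_iset (D : Subring F) (I : Ideal ↥D) :
    setMul (D : Set F) (iset D ↑I) = iset D ↑I := by
  refine Set.Subset.antisymm ?_ fun y hy => ⟨1, D.one_mem, y, hy, by simp⟩
  rintro _ ⟨x, hx, _, ⟨y, hy, rfl⟩, rfl⟩
  exact ⟨⟨x, hx⟩ * y, I.mul_mem_left _ hy, rfl⟩

theorem dinv_eq_of_dv_eq {D : Subring F} {A : Set F} (hA : A ⊆ D)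
    (h : dv (D : Set F) A = D) : dinv (D : Set F) A = D := by
  refine Set.Subset.antisymm (fun x hx => ?_) fun x hx y hy => D.mul_mem hx (hA hy)
  simpa using (dv_eq_iff_one_mem hA).1 h x hx

theorem isHDomain_iff_dt_eq_iff_dv_eq (D : Subring F) :
    IsHDomain D ↔ ∀ I : Ideal ↥D, I ≠ ⊥ →
      (dt ↑D (iset D ↑I) = (↑D : Set F) ↔ dv ↑D (iset D ↑I) = (↑D : Set F)) := by
  constructor
  · intro h I hI
    have hID := iset_subset D (I : Set ↥D)
    constructor
    · rw [dt_eq_iff_one_mem hID, dv_eq_iff_one_mem hID]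
      exact fun h1 => dt_subset_dv _ _ h1
    · intro hv
      have := h I hI
      rw [VInv, TInv, dinv_eq_of_dv_eq hID hv, setMul_iset] at this
      exact this hv
  · intro h I hI hv
    have hsub := setMul_dinv_subset D (iset D (I : Set ↥D))
    obtain ⟨y, hy, hy0⟩ := Submodule.exists_mem_ne_zero_of_ne_bot hI
    have hymem : y ∈ ((↑) ⁻¹' setMul (dinv (D : Set F) (iset D ↑I)) (iset D ↑I) : Set ↥D) :=
      ⟨1, fun z hz => by simpa using iset_subset D _ hz, y, mem_iset.2 hy, by simp⟩
    have hJ := h (Ideal.span ((↑) ⁻¹' setMul (dinv (D : Set F) (iset D ↑I)) (iset D ↑I)))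
      fun hbot => hy0 (by simpa [hbot] using Ideal.subset_span hymem)
    rw [dt_iset_span hymem hy0, dv_iset_span, iset_preimage hsub] at hJ
    exact hJ.2 hv

theorem isVMax_of_dt_eq_iff_dv_eq {D : Subring F}
    (h : ∀ I : Ideal ↥D, I ≠ ⊥ →
      (dt ↑D (iset D ↑I) = (↑D : Set F) ↔ dv ↑D (iset D ↑I) = (↑D : Set F)))
    {p : Ideal ↥D} (hp : IsTMax D p) : IsVMax D p := by
  obtain ⟨hpt, hpT, hmax⟩ := hp
  have hp0 := hpT.ne_bot
  have hpD := iset_subset D (p : Set ↥D)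
  have h1 : (1 : F) ∉ dv (D : Set F) (iset D ↑p) := by
    rw [← dv_eq_iff_one_mem hpD, ← h p hp0, show dt _ _ = _ from hpT]
    exact fun hD => one_notMem_iset hpt (hD.symm.subset D.one_mem)
  have hle : p ≤ dinvIdeal D (dinv (D : Set F) (iset D ↑p)) :=
    fun x hx => subset_dv _ _ (mem_iset.2 hx)
  have hpv : iset D (dinvIdeal D (dinv (D : Set F) (iset D ↑p)) : Set ↥D) =
      dv (D : Set F) (iset D ↑p) := by
    rw [coe_dinvIdeal]
    exact iset_preimage (dv_subset hpD)
  have hpV : IsVIdeal (D : Set F)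
      (iset D (dinvIdeal D (dinv (D : Set F) (iset D ↑p)) : Set ↥D)) := by
    rw [hpv]
    exact dv_dinv _ _
  have heq : p = dinvIdeal D (dinv (D : Set F) (iset D ↑p)) := by
    refine hmax _ ?_ (hpV.isTIdeal (ne_bot_of_le_ne_bot hp0 hle)) hle
    rw [Ideal.ne_top_iff_one]
    exact h1
  refine ⟨hpt, heq ▸ hpV, fun q hq hqV hpq => ?_⟩
  exact hmax q hq (hqV.isTIdeal (ne_bot_of_le_ne_bot hp0 hpq)) hpq

theorem iset_conductor {D : Subring F} {a b : ↥D} (ha : a ≠ 0) :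
    iset D (Conductor D a b) = dinv (D : Set F) {1, (b : F) / a} := by
  have ha' : (a : F) ≠ 0 := by simpa using ha
  ext x
  constructor
  · rintro ⟨d, ⟨c, hc⟩, rfl⟩ y (rfl | rfl)
    · simp
    · have : (d : F) * (b / a) = c := by
        rw [← mul_div_assoc, div_eq_iff ha', mul_comm (c : F)]
        exact_mod_cast hc
      rw [this]
      exact c.2
  · intro hx
    have hxD : x ∈ D := by simpa using hx 1 (by simp)
    refine ⟨⟨x, hxD⟩, ⟨⟨_, hx ((b : F) / a) (by simp)⟩, ?_⟩, rfl⟩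
    ext
    push_cast
    field_simp

theorem exists_eq_conductor_of_isVMax {D : Subring F} (hqf : IsQuotField D) {p : Ideal ↥D}
    (hp : IsVMax D p) : ∃ a b : ↥D, a ≠ 0 ∧ (↑p : Set ↥D) = Conductor D a b := by
  obtain ⟨hpt, hpV, hmax⟩ := hp
  have h1 : (1 : F) ∉ dv (D : Set F) (iset D ↑p) := by
    rw [show dv _ _ = _ from hpV]
    exact one_notMem_iset hpt
  obtain ⟨x, hx, hxD⟩ : ∃ x ∈ dinv (D : Set F) (iset D ↑p), x ∉ D := by
    by_contra! hall
    exact h1 fun x hx => by simpa using hall x hx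
  obtain ⟨b, a, ha, hab⟩ := hqf x
  have ha' : (a : F) ≠ 0 := by simpa using ha
  obtain rfl : x = b / a := by rw [eq_div_iff ha', mul_comm, hab]
  refine ⟨a, b, ha, ?_⟩
  have hsub : dinv (D : Set F) {1, (b : F) / a} ⊆ D :=
    fun y hy => by simpa using hy 1 (by simp)
  have hq : iset D (dinvIdeal D {1, (b : F) / a} : Set ↥D) =
      dinv (D : Set F) {1, (b : F) / a} := by
    rw [coe_dinvIdeal, iset_preimage hsub]
  have heq : p = dinvIdeal D {1, (b : F) / a} := by
    refine hmax _ ?_ ?_ ?_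
    · rw [Ideal.ne_top_iff_one]
      exact fun h => hxD (by simpa using h ((b : F) / a) (by simp))
    · rw [hq]
      exact dv_dinv _ _
    · rintro d hd y (rfl | rfl)
      · rw [mul_one]
        exact d.2
      · have := hx d (mem_iset.2 hd)
        rwa [mul_comm] at this
  have hset : iset D (p : Set ↥D) = iset D (Conductor D a b) := by
    rw [iset_conductor ha, ← hq, ← heq]
  exact Subtype.val_injective.image_injective hset

theorem dt_eq_iff_dv_eq_of_eq_conductor {D : Subring F}
    (h : ∀ p : Ideal ↥D, IsTMax D p →
      ∃ a b : ↥D, a ≠ 0 ∧ (↑p : Set ↥D) = Conductor D a b)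
    {I : Ideal ↥D} (hI : I ≠ ⊥) :
    dt ↑D (iset D ↑I) = (↑D : Set F) ↔ dv ↑D (iset D ↑I) = (↑D : Set F) := by
  have hID := iset_subset D (I : Set ↥D)
  rw [dt_eq_iff_one_mem hID, dv_eq_iff_one_mem hID]
  refine ⟨fun h1 => dt_subset_dv _ _ h1, fun hv => ?_⟩
  by_contra ht
  obtain ⟨p, hp, hle⟩ := exists_isTMax_ge (I := tIdeal D I hI)
    ((Ideal.ne_top_iff_one _).2 ht) (isTIdeal_tIdeal hI)
  obtain ⟨a, b, ha, hab⟩ := h p hp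
  have hIp : iset D (I : Set ↥D) ⊆ iset D (p : Set ↥D) := iset_mono ((le_tIdeal hI).trans hle)
  have h1 := dv_mono hIp hv
  rw [hab, iset_conductor ha, dv_dinv, ← iset_conductor ha, ← hab] at h1
  exact one_notMem_iset hp.1 h1

end IVP

/-- For a domain `D` with quotient field `K ≠ D` the following are
equivalent: (1) every v-invertible nonzero ideal is t-invertible; (2) every t-maximal
ideal is v-maximal; (3) every t-maximal ideal is a conductor ideal; (4) for every
nonzero ideal `I`, `I_t = D ↔ I_v = D`. -/
theorem stmt_6 (F : Type) [Field F] (D : Subring F)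
    (hqf : IsQuotField D) (hne : (↑D : Set F) ≠ Set.univ) :
    (IsHDomain D ↔ ∀ p : Ideal ↥D, IsTMax D p → IsVMax D p) ∧
      (IsHDomain D ↔ ∀ p : Ideal ↥D, IsTMax D p →
        ∃ a b : ↥D, a ≠ 0 ∧ (↑p : Set ↥D) = Conductor D a b) ∧
      (IsHDomain D ↔ ∀ I : Ideal ↥D, I ≠ ⊥ →
        (dt ↑D (iset D ↑I) = (↑D : Set F) ↔ dv ↑D (iset D ↑I) = (↑D : Set F))) := by
  have h_iff := isHDomain_iff_dt_eq_iff_dv_eq D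
  exact ⟨⟨fun h _ => isVMax_of_dt_eq_iff_dv_eq (h_iff.1 h), fun h => h_iff.2 fun _ =>
      dt_eq_iff_dv_eq_of_eq_conductor fun p hp => exists_eq_conductor_of_isVMax hqf (h p hp)⟩,
    ⟨fun h _ hp => exists_eq_conductor_of_isVMax hqf (isVMax_of_dt_eq_iff_dv_eq (h_iff.1 h) hp),
      fun h => h_iff.2 fun _ => dt_eq_iff_dv_eq_of_eq_conductor h⟩, h_iff⟩
end

section
/- Let A be a t-linked extension of an integral domain D. Then: (a) if B is a t-linked extension of A, then B is a t-linked extension of D; (b) every flat extension B of D (B an integral domain containing D that is flat as a D-module) is a t-linked extension of D. -/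
open IVP Polynomial

/-- If `0` is the only element of `R ⧸ sR` killed by all `t i`, the same holds for `M ⧸ sM`
when `M` is flat over `R`. -/
theorem Module.Flat.exists_eq_smul_of_forall_smul_eq_smul {R M ι : Type*} [CommRing R]
    [AddCommGroup M] [Module R M] [Module.Flat R M] [Finite ι] (s : R) (t : ι → R)
    (h : ∀ d, (∀ i, s ∣ t i * d) → s ∣ d) (b : M) (hb : ∀ i, ∃ m : M, t i • b = s • m) :
    ∃ m : M, b = s • m := by
  classical
  have := Fintype.ofFinite ι
  choose m hm using hb
  let f : (ι → R) →ₗ[R] (ι → R) × R := (s • LinearMap.id).prod (-Fintype.linearCombination R t)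
  let x : (ι → R) × R →ₗ[R] M :=
    (Fintype.linearCombination R m).coprod (LinearMap.toSpanSingleton R M b)
  have hxf : x ∘ₗ f = 0 := by
    refine LinearMap.pi_ext' fun i => LinearMap.ext_ring ?_
    simp [x, f, Fintype.linearCombination_apply_single, ← Pi.single_smul, ← hm i]
  obtain ⟨k, a, y, hx, haf⟩ := Module.Flat.exists_factorization_of_comp_eq_zero_of_free hxf
  have hdvd (j : Fin k) : s ∣ a (0, 1) j := by
    refine h _ fun i => ⟨a (Pi.single i 1, 0) j, ?_⟩
    have hf : f (Pi.single i 1) = s • (Pi.single i 1, 0) - t i • (0, 1) := by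
      simp [f, Fintype.linearCombination_apply_single]
    have h0 : a (f (Pi.single i 1)) = 0 := LinearMap.congr_fun haf _
    rw [hf, map_sub, map_smul, map_smul, sub_eq_zero] at h0
    simpa using (DFunLike.congr_fun h0 j).symm
  choose c hc using hdvd
  have hw : a (0, 1) = s • Finsupp.equivFunOnFinite.symm c := by
    ext j
    simpa using hc j
  refine ⟨y (Finsupp.equivFunOnFinite.symm c), ?_⟩
  rw [← map_smul, ← hw, ← LinearMap.comp_apply, ← hx]
  simp [x]

namespace IVP

/-- The t-closure of an ideal is the whole ring exactly when the ideal contains a finite set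
with trivial inverse. -/
theorem dt_iset_eq_iff {F : Type} [Field F] (D : Subring F) (I : Ideal ↥D) :
    dt ↑D (iset D ↑I) = (↑D : Set F) ↔
      ∃ T : Finset F, ↑T ⊆ iset D ↑I ∧ (∃ y ∈ T, y ≠ 0) ∧ dinv ↑D ↑T ⊆ (↑D : Set F) := by
  constructor
  · intro h
    obtain ⟨T, hTI, hT0, hT⟩ : (1 : F) ∈ dt ↑D (iset D ↑I) := h.symm.subset D.one_mem
    exact ⟨T, hTI, hT0, fun x hx => by simpa using hT x hx⟩
  · rintro ⟨T, hTI, hT0, hT⟩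
    refine Set.Subset.antisymm ?_ fun x hx =>
      ⟨T, hTI, hT0, fun y hy => D.mul_mem hx (hT hy)⟩
    rintro x ⟨U, hUI, -, hU⟩
    have h1 : (1 : F) ∈ dinv (↑D : Set F) ↑U := fun y hy => by
      obtain ⟨z, -, rfl⟩ := hUI hy
      simp
    simpa using hU 1 h1

theorem extHom_injective {F L : Type} [Field F] [Field L] (D : Subring F) (φ : F →+* L)
    (A : Subring L) (h : ExtMem D φ A) : Function.Injective (extHom D φ A h) :=
  fun _ _ hxy => Subtype.ext (φ.injective (congrArg Subtype.val hxy))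

theorem TLinkedExt.comp {F L M : Type} [Field F] [Field L] [Field M] {D : Subring F}
    {φ : F →+* L} {A : Subring L} {hA : ExtMem D φ A} {ψ : L →+* M} {B : Subring M}
    {hB : ExtMem A ψ B} (hDA : TLinkedExt D φ A hA) (hAB : TLinkedExt A ψ B hB) :
    TLinkedExt D (ψ.comp φ) B (fun d => hB ⟨φ d, hA d⟩) := by
  intro I hI h
  have hI' : Ideal.map (extHom D φ A hA) I ≠ ⊥ := by
    rwa [Ne, Ideal.map_eq_bot_iff_of_injective (extHom_injective D φ A hA)]
  have := hAB _ hI' (hDA I hI h)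
  rwa [Ideal.map_map] at this

theorem ExtFlat.tLinkedExt {F M : Type} [Field F] [Field M] {D : Subring F} {ψ : F →+* M}
    {B : Subring M} {hB : ExtMem D ψ B} (hflat : ExtFlat D ψ B hB) : TLinkedExt D ψ B hB := by
  classical
  intro I _ h
  rw [dt_iset_eq_iff] at h ⊢
  obtain ⟨T, hTI, ⟨s, hsT, hs⟩, hT⟩ := h
  have hTD {t : F} (ht : t ∈ T) : t ∈ D := by
    obtain ⟨z, -, rfl⟩ := hTI ht
    exact z.2
  refine ⟨T.image ψ, ?_, ⟨ψ s, Finset.mem_image_of_mem ψ hsT, by simpa using hs⟩, ?_⟩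
  · intro y hy
    obtain ⟨t, ht, rfl⟩ := Finset.mem_image.1 (Finset.mem_coe.1 hy)
    obtain ⟨z, hz, rfl⟩ := hTI ht
    exact ⟨extHom D ψ B hB z, Ideal.mem_map_of_mem _ hz, rfl⟩
  · intro x hx
    have hxt {t : F} (ht : t ∈ T) : x * ψ t ∈ B :=
      hx _ (Finset.mem_coe.2 (Finset.mem_image_of_mem ψ ht))
    let _ : Module ↥D ↥B := Module.compHom ↥B (extHom D ψ B hB)
    have : Module.Flat ↥D ↥B := hflat
    have hsmul (d : ↥D) (b : ↥B) : ((d • b : ↥B) : M) = ψ d * b := rfl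
    obtain ⟨m, hm⟩ := Module.Flat.exists_eq_smul_of_forall_smul_eq_smul
      (⟨s, hTD hsT⟩ : ↥D) (fun t : T => ⟨t, hTD t.2⟩)
      (fun d hd => by
        have hmem : (d : F) / s ∈ dinv (↑D : Set F) ↑T := fun t ht => by
          obtain ⟨c, hc⟩ := hd ⟨t, ht⟩
          have hc' : t * d = s * c := congrArg Subtype.val hc
          have : (d : F) / s * t = c := by field_simp; linear_combination hc'
          rw [this]
          exact c.2
        refine ⟨⟨_, hT hmem⟩, Subtype.ext ?_⟩
        change (d : F) = s * (d / s)
        field_simp)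
      (⟨x * ψ s, hxt hsT⟩ : ↥B)
      (fun t => ⟨⟨x * ψ t, hxt t.2⟩, Subtype.ext <| by
        rw [hsmul, hsmul]
        change ψ t * (x * ψ s) = ψ s * (x * ψ t)
        ring⟩)
    have hm' : x * ψ s = ψ s * m := congrArg Subtype.val hm
    have hs' : ψ s ≠ 0 := by simpa using hs
    have : x = m := mul_left_cancel₀ hs' (by linear_combination hm')
    rw [this]
    exact m.2

end IVP

/-- Let `A` be a t-linked extension of `D`.  (a) If `B` is a t-linked
extension of `A`, then `B` is a t-linked extension of `D`.  (b) Every flat extension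
`B` of `D` is a t-linked extension of `D`. -/
theorem stmt_8 (F : Type) [Field F] (L : Type) [Field L]
    (D : Subring F) (φ : F →+* L) (A : Subring L) (hA : ExtMem D φ A)
    (hTL : TLinkedExt D φ A hA) :
    (∀ (M : Type) [Field M], ∀ (ψ : L →+* M) (B : Subring M) (hB : ExtMem A ψ B),
        TLinkedExt A ψ B hB →
          TLinkedExt D (ψ.comp φ) B (fun d => hB ⟨φ d, hA d⟩)) ∧
      ∀ (M : Type) [Field M], ∀ (ψ : F →+* M) (B : Subring M) (hB : ExtMem D ψ B),
        ExtFlat D ψ B hB → TLinkedExt D ψ B hB := by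
  exact ⟨fun _ _ _ _ _ h => hTL.comp h, fun _ _ _ _ _ h => h.tLinkedExt⟩
end

section
/- Let D be an integral domain with quotient field K ≠ D and let p be a prime ideal of D. Then Int(D_p) = D_p[X] if and only if both Int(D) ⊆ D_p[X] and Int(D_p) = Int(D)_p. -/
open IVP Polynomial

namespace IVP

variable {F : Type} [Field F] {D : Subring F} {p : Ideal ↥D}

theorem mem_primeLoc (hp : p.IsPrime) {x : F} : x ∈ primeLoc D p hp ↔ x ∈ plocSet D p :=
  Iff.rfl

theorem le_primeLoc (hp : p.IsPrime) : D ≤ primeLoc D p hp := fun x hx =>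
  ⟨⟨x, hx⟩, 1, fun h => hp.ne_top ((Ideal.eq_top_iff_one p).2 h), by simp⟩

/-- Elements of `D ∖ p` can be cancelled in `D_p`. -/
theorem mem_primeLoc_of_mul_mem (hp : p.IsPrime) {s : ↥D} (hs : s ∉ p) {x : F}
    (h : (s : F) * x ∈ primeLoc D p hp) : x ∈ primeLoc D p hp := by
  obtain ⟨a, t, ht, hx⟩ := h
  refine ⟨a, t * s, fun h => (hp.mem_or_mem h).elim ht hs, ?_⟩
  push_cast
  rw [mul_assoc, hx]

/-- A polynomial mapping `D` into `D_p` maps `D_p` into `D_p`. -/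
theorem intOn_plocSet_subset (hp : p.IsPrime) :
    IntOn (↑D : Set F) (plocSet D p) ⊆ IntR (plocSet D p) := by
  suffices h : ∀ (n : ℕ) (f : F[X]), f.degree < n → (∀ x ∈ D, f.eval x ∈ primeLoc D p hp) →
      ∀ x ∈ primeLoc D p hp, f.eval x ∈ primeLoc D p hp from fun f hf =>
    h (f.natDegree + 1) f
      (degree_le_natDegree.trans_lt (by exact_mod_cast Nat.lt_succ_self _)) hf
  intro n
  induction n with
  | zero =>
    intro f hf _ x _
    have : f = 0 := by simpa [Polynomial.degree_lt_iff_coeff_zero, Polynomial.ext_iff] using hf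
    simp [this, zero_mem]
  | succ n ih =>
    intro f hf hD x hx
    obtain ⟨a, s, hs, hsx⟩ := id hx
    have hspow : s ^ n ∉ p := fun h => hs (hp.mem_of_pow_mem n h)
    have hg := ih (C ((s : F) ^ n) * f - f.comp (C (s : F) * X)) ?_ ?_ x hx
    · refine mem_primeLoc_of_mul_mem hp hspow ?_
      have := add_mem hg (hD a a.2)
      simpa [hsx] using this
    · rw [degree_lt_iff_coeff_zero] at hf ⊢
      intro m hm
      rw [coeff_sub, coeff_C_mul, comp_C_mul_X_coeff]
      rcases hm.eq_or_lt with rfl | hm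
      · ring
      · simp [hf m hm]
    · intro y hy
      simpa using sub_mem
        (mul_mem (le_primeLoc hp (pow_mem s.2 n)) (hD y hy))
        (hD _ (mul_mem s.2 hy))

theorem exists_common_denominator (hp : p.IsPrime) (T : Finset F) (hT : ↑T ⊆ plocSet D p) :
    ∃ s : ↥D, s ∉ p ∧ ∀ x ∈ T, (s : F) * x ∈ D := by
  classical
  induction T using Finset.induction_on with
  | empty => exact ⟨1, fun h => hp.ne_top ((Ideal.eq_top_iff_one p).2 h), by simp⟩
  | insert x T _ ih =>
    rw [Finset.coe_insert, Set.insert_subset_iff] at hT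
    obtain ⟨t, ht, htT⟩ := ih hT.2
    obtain ⟨a, s, hs, hsx⟩ := hT.1
    refine ⟨s * t, fun h => (hp.mem_or_mem h).elim hs ht, fun y hy => ?_⟩
    push_cast
    rcases Finset.mem_insert.1 hy with rfl | hy
    · rw [mul_right_comm, hsx]
      exact mul_mem a.2 t.2
    · rw [mul_assoc]
      exact mul_mem s.2 (htT y hy)

theorem eval_mem_of_coeff_mem {A : Subring F} {f : F[X]} (hf : ∀ n, f.coeff n ∈ A) {x : F}
    (hx : x ∈ A) : f.eval x ∈ A := by
  rw [eval_eq_sum]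
  exact sum_mem fun n _ => mul_mem (hf n) (pow_mem hx n)

theorem polySet_subset_intR (A : Subring F) : polySet (↑A : Set F) ⊆ IntR ↑A :=
  fun _ hf _ hx => eval_mem_of_coeff_mem hf hx

/-- `D_p[X] ⊆ Int(D)_p`. -/
theorem polySet_plocSet_subset (hp : p.IsPrime) :
    polySet (plocSet D p) ⊆ plocPoly D p (IntR (↑D : Set F)) := by
  classical
  intro f hf
  obtain ⟨s, hs, h⟩ := exists_common_denominator hp (f.support.image f.coeff) (by
    intro y hy
    obtain ⟨n, -, rfl⟩ := Finset.mem_image.1 (Finset.mem_coe.1 hy)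
    exact hf n)
  refine ⟨_, polySet_subset_intR D fun n => ?_, s, hs, rfl⟩
  rw [coeff_C_mul]
  by_cases hn : n ∈ f.support
  · exact h _ (Finset.mem_image_of_mem _ hn)
  · simp [notMem_support_iff.1 hn]

theorem intR_subset_intR_plocSet (hp : p.IsPrime) :
    IntR (↑D : Set F) ⊆ IntR (plocSet D p) := fun _ hf =>
  intOn_plocSet_subset hp fun x hx => le_primeLoc hp (hf x hx)

/-- `Int(D)_p ⊆ Int(D_p)`. -/
theorem plocPoly_intR_subset (hp : p.IsPrime) :
    plocPoly D p (IntR (↑D : Set F)) ⊆ IntR (plocSet D p) := by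
  rintro f ⟨g, hg, s, hs, rfl⟩ x hx
  refine mem_primeLoc_of_mul_mem hp hs ?_
  simpa using (mem_primeLoc hp).2 (intR_subset_intR_plocSet hp hg x hx)

/-- `(D_p[X])_p ⊆ D_p[X]`. -/
theorem plocPoly_polySet_subset (hp : p.IsPrime) :
    plocPoly D p (polySet (plocSet D p)) ⊆ polySet (plocSet D p) := by
  rintro f ⟨g, hg, s, hs, rfl⟩ n
  refine mem_primeLoc_of_mul_mem hp hs ?_
  simpa using (mem_primeLoc hp).2 (hg n)

end IVP

/-- `p` is a strong polynomial prime iff it is a polynomial prime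
and `Int(D_p) = Int(D)_p`: that is, `Int(D_p) = D_p[X]` iff `Int(D) ⊆ D_p[X]` and
`Int(D_p) = Int(D)_p`. -/
theorem stmt_10 (F : Type) [Field F] (D : Subring F)
    (hqf : IsQuotField D) (hne : (↑D : Set F) ≠ Set.univ)
    (p : Ideal ↥D) (hp : p.IsPrime) :
    IntR (plocSet D p) = polySet (plocSet D p) ↔
      IntR (↑D : Set F) ⊆ polySet (plocSet D p) ∧
        IntR (plocSet D p) = plocPoly D p (IntR (↑D : Set F)) := by
  constructor
  · intro h
    exact ⟨h ▸ intR_subset_intR_plocSet hp,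
      (h ▸ polySet_plocSet_subset hp).antisymm (plocPoly_intR_subset hp)⟩
  · rintro ⟨h, hloc⟩
    refine Set.Subset.antisymm ?_ (polySet_subset_intR (primeLoc D p hp))
    rw [hloc]
    rintro f ⟨g, hg, s, hs, hfg⟩
    exact plocPoly_polySet_subset hp ⟨g, h hg, s, hs, hfg⟩
end
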